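/- (Gallai–Edmonds, part (e)) Let G be a finite simple graph on vertex set V(G), let D(G) be the set of vertices v of G such that some maximum matching of G does not cover v, let A(G) be the set of vertices in V(G) \ D(G) adjacent to at least one vertex of D(G), and let q be the number of connected components of the subgraph of G induced by D(G). Then the size of a maximum matching of G equals (|V(G)| - q + |A(G)|)/2. -/

import Mathlib

/-- `s` is a matching of the graph `G`: a set of pairwise disjoint edges of `G`. -/
def IsMatchingFinset {V : Type*} (G : SimpleGraph V) (s : Finset (Sym2 V)) : Prop :=
  (∀ e ∈ s, e ∈ G.edgeSet) ∧ (s : Set (Sym2 V)).Pairwise fun e f => ∀ v, v ∈ e → v ∉ f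

/-- `s` is a maximum matching of `G`: a matching of maximum cardinality. -/
def IsMaximumMatchingFinset {V : Type*} (G : SimpleGraph V) (s : Finset (Sym2 V)) : Prop :=
  IsMatchingFinset G s ∧ ∀ t : Finset (Sym2 V), IsMatchingFinset G t → t.card ≤ s.card

/-- `D(G)`: the set of vertices missed by at least one maximum matching of `G`. -/
def gallaiD {V : Type*} (G : SimpleGraph V) : Set V :=
  {v | ∃ s : Finset (Sym2 V), IsMaximumMatchingFinset G s ∧ ∀ e ∈ s, v ∉ e}

/-- `A(G)`: the set of vertices outside `D(G)` adjacent to at least one vertex of `D(G)`. -/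
def gallaiA {V : Type*} (G : SimpleGraph V) : Set V :=
  {v | v ∉ gallaiD G ∧ ∃ u ∈ gallaiD G, G.Adj v u}

namespace SimpleGraph

variable {V : Type*}

/-- A matching of `G`, encoded as the involution exchanging matched vertices and fixing the
uncovered ones. -/
def IsMatchingInvolution (G : SimpleGraph V) (f : V → V) : Prop :=
  Function.Involutive f ∧ ∀ v, f v ≠ v → G.Adj v (f v)

/-- A matching involution with the fewest fixed points. -/
def IsMaximumInvolution (G : SimpleGraph V) (f : V → V) : Prop :=
  IsMatchingInvolution G f ∧
    ∀ g, IsMatchingInvolution G g → (Function.fixedPoints f).ncard ≤ (Function.fixedPoints g).ncard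

/-- The vertices fixed by some maximum involution. -/
def missable (G : SimpleGraph V) : Set V :=
  {v | ∃ f, IsMaximumInvolution G f ∧ f v = v}

theorem IsMatchingInvolution.ncard_fixedPoints_mod_two [Fintype V] {G : SimpleGraph V} {f g : V → V}
    (hf : IsMatchingInvolution G f) (hg : IsMatchingInvolution G g) :
    (Function.fixedPoints f).ncard % 2 = (Function.fixedPoints g).ncard % 2 := by
  classical
  have key : ∀ f : V → V, Function.Involutive f →
      Fintype.card V % 2 = (Function.fixedPoints f).ncard % 2 := by
    intro f hf
    have := Equiv.Perm.card_fixedPoints_modEq (p := 2) (n := 1) (f := f)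
      ((pow_two (M := Function.End V) f).trans (funext hf))
    rw [← Nat.card_coe_set_eq, Nat.card_eq_fintype_card]
    exact this
  rw [← key f hf.1, key g hg.1]

variable {G : SimpleGraph V} {f g h : V → V} {a u v w x y : V}

/-- The adjacency relation of the subgraph induced by the missable vertices. -/
def MissableAdj (G : SimpleGraph V) (x y : V) : Prop :=
  x ∈ missable G ∧ y ∈ missable G ∧ G.Adj x y

/-- The vertices outside `missable G` with a neighbour in it. -/
def missableBoundary (G : SimpleGraph V) : Set V :=
  {v | v ∉ missable G ∧ ∃ u ∈ missable G, G.Adj v u}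

/-- The missable vertices that `f` does not match to another missable vertex. -/
def exits (G : SimpleGraph V) (f : V → V) : Set V :=
  {v | v ∈ missable G ∧ (f v = v ∨ f v ∉ missable G)}

theorem IsMatchingInvolution.of_deleteIncidenceSet
    (hh : IsMatchingInvolution (G.deleteIncidenceSet a) h) :
    IsMatchingInvolution G h ∧ h a = a := by
  refine ⟨⟨hh.1, fun v hv => (deleteIncidenceSet_adj.1 (hh.2 v hv)).1⟩, ?_⟩
  by_contra ha
  exact (deleteIncidenceSet_adj.1 (hh.2 a ha)).2.1 rfl

theorem IsMaximumInvolution.apply_mem_missableBoundary (hf : IsMaximumInvolution G f)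
    (hx : x ∈ exits G f) (hfx : f x ≠ x) : f x ∈ missableBoundary G :=
  ⟨hx.2.resolve_left hfx, x, hx.1, (hf.1.2 x hfx).symm⟩

theorem reachable_induce_iff {x y : missable G} :
    (G.induce (missable G)).Reachable x y ↔
      Relation.ReflTransGen (MissableAdj G) (x : V) y := by
  constructor
  · rw [reachable_iff_reflTransGen]
    intro h
    exact h.lift Subtype.val fun a b hab => ⟨a.2, b.2, hab⟩
  · obtain ⟨x, hx⟩ := x
    obtain ⟨y, hy⟩ := y
    intro h
    dsimp only at h
    induction h with
    | refl => rfl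
    | tail _ hbc ih =>
      exact (ih hbc.1).trans (Adj.reachable (G := G.induce _) hbc.2.2)

variable [Finite V]

theorem IsMatchingInvolution.link (hh : IsMatchingInvolution G h) (hu : h u = u) (hw : h w = w)
    (huw : G.Adj u w) : ∃ k, IsMatchingInvolution G k ∧
      (Function.fixedPoints k).ncard + 2 = (Function.fixedPoints h).ncard ∧
      ∀ z, z ≠ u → z ≠ w → k z = h z := by
  classical
  have hne := huw.ne
  have hh1 := hh.1
  refine ⟨fun z => if z = u then w else if z = w then u else h z, ⟨?_, ?_⟩, ?_, ?_⟩
  · intro z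
    have := hh1 z
    grind
  · intro z hz
    have := hh.2 z
    have := huw.symm
    grind
  · have : Function.fixedPoints h = insert u (insert w
        (Function.fixedPoints fun z => if z = u then w else if z = w then u else h z)) := by
      ext z
      simp only [Function.mem_fixedPoints, Function.IsFixedPt, Set.mem_insert_iff]
      grind
    rw [this, Set.ncard_insert_of_notMem, Set.ncard_insert_of_notMem]
    · simp only [Function.mem_fixedPoints, Function.IsFixedPt]; grind
    · simp only [Function.mem_fixedPoints, Function.IsFixedPt, Set.mem_insert_iff]; grind
  · grind

theorem IsMaximumInvolution.not_adj (hh : IsMaximumInvolution G h) (hu : h u = u) (hw : h w = w) :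
    ¬ G.Adj u w := by
  intro huw
  obtain ⟨k, hk, hc, -⟩ := hh.1.link hu hw huw
  have := hh.2 k hk
  omega

/-- Replacing the edge at `w` by the edge `uw`, where `u` is uncovered. -/
theorem IsMaximumInvolution.rotate (hh : IsMaximumInvolution G h) (hu : h u = u)
    (huw : G.Adj u w) : ∃ k, IsMaximumInvolution G k ∧ k u = w ∧ k w = u ∧ k (h w) = h w ∧
      ∀ z, z ≠ u → z ≠ w → z ≠ h w → k z = h z := by
  classical
  have hne := huw.ne
  have hw : h w ≠ w := fun hw => hh.not_adj hu hw huw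
  have hh1 := hh.1.1
  have hwu : h w ≠ u := by
    intro e
    have := hh1 w
    grind
  let k : V → V := fun z => if z = u then w else if z = w then u else if z = h w then h w else h z
  have hk : IsMatchingInvolution G k := by
    refine ⟨?_, ?_⟩
    · intro z
      have h1 := hh1 z
      have h2 := hh1 w
      grind
    · intro z hz
      have := hh.1.2 z
      have := huw.symm
      grind
  have hfix : Function.fixedPoints k = insert (h w) (Function.fixedPoints h \ {u}) := by
    ext z
    have := hh1 w
    simp only [Function.mem_fixedPoints, Function.IsFixedPt, Set.mem_insert_iff, Set.mem_sdiff,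
      Set.mem_singleton_iff]
    grind
  have hcard : (Function.fixedPoints k).ncard = (Function.fixedPoints h).ncard := by
    rw [hfix, Set.ncard_exchange]
    · simp only [Function.mem_fixedPoints, Function.IsFixedPt]
      have := hh1 w
      grind
    · exact hu
  refine ⟨k, ⟨hk, fun g hg => hcard ▸ hh.2 g hg⟩, ?_, ?_, ?_, ?_⟩ <;> grind

theorem ncard_ne_lt_ncard_ne (f g k : V → V) (h1 : ∀ z, f z = g z → f z = k z) (hu : f u ≠ g u)
    (hu' : f u = k u) : {z | f z ≠ k z}.ncard < {z | f z ≠ g z}.ncard := by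
  refine Set.ncard_lt_ncard ⟨fun z hz e => hz (h1 z e), fun hs => hs (show u ∈ _ from hu) hu'⟩

/-- The sets of uncovered vertices of maximum matchings satisfy basis exchange. -/
theorem IsMaximumInvolution.exchange (hf : IsMaximumInvolution G f) (hg : IsMaximumInvolution G g)
    (hu : g u = u) : ∃ h z, IsMaximumInvolution G h ∧ h u = u ∧ (∀ y, f y = g y → h y = f y) ∧
      ∀ y, f y = y → y ≠ z → h y = y := by
  induction hn : {z | f z ≠ g z}.ncard using Nat.strong_induction_on generalizing g u with
  | _ n ih =>
  subst hn
  by_cases hfu : f u = u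
  · exact ⟨f, u, hf, hfu, fun _ _ => rfl, fun _ h _ => h⟩
  have huw := hf.1.2 u hfu
  have hffu := hf.1.1 u
  have hgw : g (f u) ≠ f u := fun e => hg.not_adj hu e huw
  have hgg := hg.1.1 (f u)
  by_cases hfx : f (g (f u)) = g (f u)
  · obtain ⟨k, hk, h1, h2, h3, h4⟩ := hf.rotate (w := f u) hfx (hg.1.2 _ hgw).symm
    refine ⟨k, g (f u), hk, by grind, ?_, ?_⟩
    · intro y hy
      refine h4 y ?_ ?_ ?_ <;> grind
    · intro y hy hyz
      rw [h4 y] <;> grind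
  · obtain ⟨k, hk, h1, h2, h3, h4⟩ := hg.rotate hu huw
    have hagree : ∀ z, f z = g z → f z = k z := by
      intro z hz
      have := hf.1.1 z
      rw [h4 z] <;> grind
    obtain ⟨m, z, hm, hmx, hma, hmz⟩ := ih _
      (ncard_ne_lt_ncard_ne f g k hagree (by grind) h1.symm) hk h3 rfl
    have hmu : m u = f u := hma u h1.symm
    have hmm := hm.1.1 u
    obtain ⟨m', hm', h1', h2', h3', h4'⟩ := hm.rotate (w := f u) hmx (hg.1.2 _ hgw).symm
    refine ⟨m', z, hm', by grind, ?_, ?_⟩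
    · intro y hy
      rw [h4' y, hma y] <;> grind
    · intro y hy hyz
      rw [h4' y, hmz y] <;> grind

/-- **Gallai's lemma**. -/
theorem IsMaximumInvolution.eq_of_reflTransGen (hxy : Relation.ReflTransGen (MissableAdj G) x y)
    (hf : IsMaximumInvolution G f) (hx : f x = x) (hy : f y = y) : x = y := by
  induction hxy generalizing f with
  | refl => rfl
  | @tail t y hxt hty ih =>
    obtain ⟨⟨g, hg, hgt⟩, -, hadj⟩ := hty
    obtain ⟨h, z, hh, hht, -, hz⟩ := hf.exchange hg hgt
    by_cases hyz : y = z
    · by_contra hne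
      have := ih hh (hz x hx (hyz ▸ hne)) hht
      subst this
      exact hf.not_adj hx hy hadj
    · exact absurd hadj (hh.not_adj hht (hz y hy hyz))

theorem IsMatchingInvolution.detach (hg : IsMatchingInvolution G g) (ha : g a ≠ a) :
    ∃ k, IsMatchingInvolution (G.deleteIncidenceSet a) k ∧
      (Function.fixedPoints k).ncard = (Function.fixedPoints g).ncard + 2 ∧
      k a = a ∧ k (g a) = g a ∧ ∀ z, z ≠ a → z ≠ g a → k z = g z := by
  classical
  have hg1 := hg.1
  have hga := hg1 a
  let k : V → V := fun z => if z = a then a else if z = g a then g a else g z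
  have hfix : Function.fixedPoints k = insert a (insert (g a) (Function.fixedPoints g)) := by
    ext z
    simp only [Function.mem_fixedPoints, Function.IsFixedPt, Set.mem_insert_iff]
    grind
  refine ⟨k, ⟨?_, ?_⟩, ?_, ?_, ?_, ?_⟩
  · intro z
    have := hg1 z
    grind
  · intro z hz
    have := hg.2 z
    have := hg1 z
    rw [deleteIncidenceSet_adj]
    grind
  · rw [hfix, Set.ncard_insert_of_notMem, Set.ncard_insert_of_notMem]
    · simp only [Function.mem_fixedPoints, Function.IsFixedPt]; grind
    · simp only [Function.mem_fixedPoints, Function.IsFixedPt, Set.mem_insert_iff]; grind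
  all_goals grind

theorem IsMaximumInvolution.add_two_le (hg : IsMaximumInvolution G g) (ha : a ∉ missable G)
    (hh : IsMatchingInvolution G h) (hha : h a = a) :
    (Function.fixedPoints g).ncard + 2 ≤ (Function.fixedPoints h).ncard := by
  cases nonempty_fintype V
  have h1 := hg.2 h hh
  have h2 := hg.1.ncard_fixedPoints_mod_two hh
  have h3 : ¬ (Function.fixedPoints h).ncard ≤ (Function.fixedPoints g).ncard := fun hle =>
    ha ⟨h, ⟨hh, fun k hk => hle.trans (hg.2 k hk)⟩, hha⟩
  omega

theorem IsMaximumInvolution.detach (hg : IsMaximumInvolution G g) (ha : a ∉ missable G) :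
    ∃ k, IsMaximumInvolution (G.deleteIncidenceSet a) k ∧
      (Function.fixedPoints k).ncard = (Function.fixedPoints g).ncard + 2 ∧
      k a = a ∧ k (g a) = g a ∧ ∀ z, z ≠ a → z ≠ g a → k z = g z := by
  have hga : g a ≠ a := fun e => ha ⟨g, hg, e⟩
  obtain ⟨k, hk, hc, hrest⟩ := hg.1.detach hga
  refine ⟨k, ⟨hk, fun h hh => ?_⟩, hc, hrest⟩
  rw [hc]
  obtain ⟨h1, h2⟩ := hh.of_deleteIncidenceSet
  exact hg.add_two_le ha h1 h2

/-- A missable vertex of `G - a` is missable in `G` if some maximum matching of `G - a` missing it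
also misses a neighbour of `a`. -/
theorem IsMaximumInvolution.mem_missable_of_deleteIncidenceSet (hg : IsMaximumInvolution G g)
    (ha : a ∉ missable G) (hh : IsMaximumInvolution (G.deleteIncidenceSet a) h)
    (hw : h w = w) (haw : G.Adj a w) (hv : h v = v) (hva : v ≠ a) (hvw : v ≠ w) :
    v ∈ missable G := by
  obtain ⟨h1, h2⟩ := hh.1.of_deleteIncidenceSet
  obtain ⟨k, hk, hc, hkz⟩ := h1.link h2 hw haw
  obtain ⟨m, hm, hmc, -⟩ := hg.detach ha
  have h3 := hh.2 m hm.1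
  refine ⟨k, ⟨hk, fun j hj => ?_⟩, by rw [hkz v hva hvw, hv]⟩
  have := hg.2 j hj
  omega

/-- The **stability lemma**. -/
theorem missable_deleteIncidenceSet (ha : a ∉ missable G) (hu : u ∈ missable G)
    (hau : G.Adj a u) : missable (G.deleteIncidenceSet a) = insert a (missable G) := by
  obtain ⟨g, hg, hgu⟩ := hu
  have hga : g a ≠ a := fun e => ha ⟨g, hg, e⟩
  have hgga := hg.1.1 a
  obtain ⟨k, hk, hkc, hka, hkga, hkz⟩ := hg.detach ha
  apply Set.Subset.antisymm
  · rintro v ⟨h, hh, hhv⟩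
    by_cases hva : v = a
    · exact Or.inl hva
    refine Or.inr ?_
    by_cases hvu : v = u
    · exact hvu ▸ ⟨g, hg, hgu⟩
    obtain ⟨m, z, hm, hmv, -, hmz⟩ := hk.exchange hh hhv
    have hku : k u = u := by
      rw [hkz u hau.ne.symm (by grind), hgu]
    by_cases huz : u = z
    · have hmga : m (g a) = g a := hmz _ hkga (by grind)
      by_cases hvga : v = g a
      · subst hvga
        have hua : u ≠ g a := by grind
        exact hg.mem_missable_of_deleteIncidenceSet ha hk hku hau hkga hva hvu
      · exact hg.mem_missable_of_deleteIncidenceSet ha hm hmga (hg.1.2 a hga) hmv hva hvga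
    · exact hg.mem_missable_of_deleteIncidenceSet ha hm (hmz u hku huz) hau hmv hva hvu
  · rintro v (rfl | ⟨f, hf, hfv⟩)
    · exact ⟨k, hk, hka⟩
    · obtain ⟨m, hm, -, hma, -, hmz⟩ := hf.detach ha
      refine ⟨m, hm, ?_⟩
      by_cases hva : v = a
      · exact hva ▸ hma
      · have := hf.1.1 a
        rw [hmz v hva (by grind), hfv]

theorem IsMaximumInvolution.apply_mem_missable (hf : IsMaximumInvolution G f)
    (ha : a ∉ missable G) (hu : u ∈ missable G) (hau : G.Adj a u) : f a ∈ missable G := by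
  obtain ⟨m, hm, -, hma, hmfa, -⟩ := hf.detach ha
  have h : f a ∈ missable (G.deleteIncidenceSet a) := ⟨m, hm, hmfa⟩
  rw [missable_deleteIncidenceSet ha hu hau] at h
  exact h.resolve_left fun e => ha ⟨f, hf, e⟩

theorem IsMaximumInvolution.exits_unique (hf : IsMaximumInvolution G f) (hx : x ∈ exits G f)
    (hy : y ∈ exits G f) (hxy : Relation.ReflTransGen (MissableAdj G) x y) : x = y := by
  induction hn : (missableBoundary G).ncard using Nat.strong_induction_on generalizing G f with
  | _ n ih =>
  subst hn
  by_cases hA : (missableBoundary G).Nonempty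
  · obtain ⟨a, ha, u, hu, hau⟩ := hA
    have hD := missable_deleteIncidenceSet ha hu hau
    obtain ⟨m, hm, -, hma, hmfa, hmz⟩ := hf.detach ha
    have hexits : ∀ v ∈ exits G f, v ∈ exits (G.deleteIncidenceSet a) m := by
      rintro v ⟨hv, hfv⟩
      refine ⟨hD ▸ Or.inr hv, ?_⟩
      rw [hD]
      have hva : v ≠ a := fun e => ha (e ▸ hv)
      have := hf.1.1 v
      by_cases hvf : v = f a
      · exact Or.inl (hvf ▸ hmfa)
      · rw [hmz v hva hvf]
        refine hfv.imp_right fun h => ?_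
        rintro (h' | h')
        · grind
        · exact h h'
    refine ih _ (Set.ncard_lt_ncard ⟨?_, fun hs => ?_⟩) hm (hexits x hx) (hexits y hy) ?_ rfl
    · rintro v ⟨hv, w, hw, hvw⟩
      rw [hD] at hv hw
      rw [deleteIncidenceSet_adj] at hvw
      exact ⟨fun h => hv (Or.inr h), w, hw.resolve_left hvw.2.2, hvw.1⟩
    · have := (hs ⟨ha, u, hu, hau⟩).1
      exact this (hD ▸ Or.inl rfl)
    · refine Relation.ReflTransGen.mono (fun v w hvw => ⟨hD ▸ Or.inr hvw.1, hD ▸ Or.inr hvw.2.1, ?_⟩)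
        _ _ hxy
      exact deleteIncidenceSet_adj.2
        ⟨hvw.2.2, fun e => ha (e ▸ hvw.1), fun e => ha (e ▸ hvw.2.1)⟩
  · have key : ∀ v ∈ exits G f, f v = v := fun v hv => by
      by_contra h
      exact hA ⟨_, hf.apply_mem_missableBoundary hv h⟩
    exact hf.eq_of_reflTransGen hxy (key x hx) (key y hy)

theorem IsMaximumInvolution.exists_exit (hf : IsMaximumInvolution G f) (hu : u ∈ missable G) :
    ∃ x ∈ exits G f, Relation.ReflTransGen (MissableAdj G) u x := by
  obtain ⟨g, hg, hgu⟩ := hu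
  induction hn : {z | f z ≠ g z}.ncard using Nat.strong_induction_on generalizing g u with
  | _ n ih =>
  subst hn
  by_cases hfu : f u = u ∨ f u ∉ missable G
  · exact ⟨u, ⟨⟨g, hg, hgu⟩, hfu⟩, .refl⟩
  push Not at hfu
  have huw := hf.1.2 u hfu.1
  have hgw : g (f u) ≠ f u := fun e => hg.not_adj hgu e huw
  have hgg := hg.1.1 (f u)
  obtain ⟨k, hk, h1, h2, h3, h4⟩ := hg.rotate hgu huw
  obtain ⟨x, hx, hux⟩ := ih _ (ncard_ne_lt_ncard_ne (u := u) f g k (fun z hz => by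
    have := hf.1.1 z
    have := hf.1.1 u
    rw [h4 z] <;> grind) (by grind) h1.symm) k hk h3 rfl
  exact ⟨x, hx, .head ⟨⟨g, hg, hgu⟩, hfu.2, huw⟩ <|
    .head ⟨hfu.2, ⟨k, hk, h3⟩, hg.1.2 _ hgw⟩ hux⟩

theorem IsMaximumInvolution.ncard_exits (hf : IsMaximumInvolution G f) :
    (exits G f).ncard = (Function.fixedPoints f).ncard + (missableBoundary G).ncard := by
  have hinj : Function.Injective f := hf.1.1.injective
  have hE : exits G f = Function.fixedPoints f ∪ f '' missableBoundary G := by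
    ext v
    constructor
    · intro hv
      by_cases hfv : f v = v
      · exact Or.inl hfv
      · exact Or.inr ⟨f v, hf.apply_mem_missableBoundary hv hfv, hf.1.1 v⟩
    · rintro (hv | ⟨a, ⟨ha, u, hu, hau⟩, rfl⟩)
      · exact ⟨⟨f, hf, hv⟩, Or.inl hv⟩
      · refine ⟨hf.apply_mem_missable ha hu hau, Or.inr ?_⟩
        rwa [hf.1.1 a]
  rw [hE, Set.ncard_union_eq, Set.ncard_image_of_injective _ hinj]
  rw [Set.disjoint_left]
  rintro _ hv ⟨a, ⟨ha, -⟩, rfl⟩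
  exact ha ⟨f, hf, hinj hv⟩

theorem IsMaximumInvolution.card_connectedComponent (hf : IsMaximumInvolution G f) :
    Nat.card (G.induce (missable G)).ConnectedComponent = (exits G f).ncard := by
  rw [← Nat.card_coe_set_eq]
  symm
  refine Nat.card_eq_of_bijective
    (fun x : exits G f => (G.induce (missable G)).connectedComponentMk ⟨x, x.2.1⟩) ⟨?_, ?_⟩
  · rintro ⟨x, hx⟩ ⟨y, hy⟩ hxy
    exact Subtype.ext (hf.exits_unique hx hy (reachable_induce_iff.1 (ConnectedComponent.exact hxy)))
  · intro c
    induction c using ConnectedComponent.ind with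
    | _ u =>
    obtain ⟨x, hx, hux⟩ := hf.exists_exit u.2
    exact ⟨⟨x, hx⟩, ConnectedComponent.sound (reachable_induce_iff.2 hux).symm⟩

end SimpleGraph

open SimpleGraph

theorem IsMatchingFinset.ncard_uncovered_add {V : Type*} [Fintype V] {G : SimpleGraph V}
    {s : Finset (Sym2 V)} (hs : IsMatchingFinset G s) :
    {v | ∀ e ∈ s, v ∉ e}.ncard + 2 * s.card = Fintype.card V := by
  classical
  have hc : (s.biUnion Sym2.toFinset).card = 2 * s.card := by
    rw [Finset.card_biUnion, Finset.sum_const_nat (m := 2), mul_comm]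
    · intro e he
      exact Sym2.card_toFinset_of_not_isDiag e (G.not_isDiag_of_mem_edgeSet (hs.1 e he))
    · intro e he f hf hef
      refine Finset.disjoint_left.2 fun v hv hv' => ?_
      exact hs.2 he hf hef v (Sym2.mem_toFinset.1 hv) (Sym2.mem_toFinset.1 hv')
  have hu : {v | ∀ e ∈ s, v ∉ e} = ((s.biUnion Sym2.toFinset)ᶜ : Finset V) := by
    ext v
    simp
  rw [hu, Set.ncard_coe_finset, ← hc, add_comm, Finset.card_add_card_compl]

theorem IsMatchingFinset.exists_involution {V : Type*} {G : SimpleGraph V}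
    {s : Finset (Sym2 V)} (hs : IsMatchingFinset G s) :
    ∃ f, IsMatchingInvolution G f ∧ Function.fixedPoints f = {v | ∀ e ∈ s, v ∉ e} := by
  classical
  have huniq : ∀ v w w', s(v, w) ∈ s → s(v, w') ∈ s → w = w' := by
    intro v w w' h h'
    by_contra hne
    exact hs.2 h h' (fun e => hne (Sym2.congr_right.1 e)) v (Sym2.mem_mk_left _ _)
      (Sym2.mem_mk_left _ _)
  have hex : ∀ v, ∃ w, s(v, w) ∈ s ∨ (w = v ∧ ∀ e ∈ s, v ∉ e) := by
    intro v
    by_cases h : ∀ e ∈ s, v ∉ e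
    · exact ⟨v, Or.inr ⟨rfl, h⟩⟩
    · push Not at h
      obtain ⟨e, he, w, rfl⟩ := h
      exact ⟨w, Or.inl he⟩
  choose f hf using hex
  have hadj : ∀ v w, s(v, w) ∈ s → G.Adj v w := fun v w h => hs.1 _ h
  refine ⟨f, ⟨fun v => ?_, fun v hv => ?_⟩, ?_⟩
  · rcases hf v with h | ⟨h, -⟩
    · rcases hf (f v) with h' | ⟨-, h'⟩
      · exact huniq _ _ _ h' (Sym2.eq_swap ▸ h)
      · exact absurd (Sym2.mem_mk_right _ _) (h' _ h)
    · rw [h, h]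
  · rcases hf v with h | ⟨h, -⟩
    · exact hadj _ _ h
    · exact absurd h hv
  · ext v
    refine ⟨fun hv => ?_, fun hv => ?_⟩
    · rcases hf v with h | ⟨-, h⟩
      · exact absurd hv (hadj _ _ h).ne.symm
      · exact h
    · rcases hf v with h | ⟨h, -⟩
      · exact absurd (Sym2.mem_mk_left _ _) (hv _ h)
      · exact h

theorem SimpleGraph.IsMatchingInvolution.exists_finset {V : Type*} [Fintype V] {G : SimpleGraph V}
    {f : V → V} (hf : IsMatchingInvolution G f) :
    ∃ s, IsMatchingFinset G s ∧ Function.fixedPoints f = {v | ∀ e ∈ s, v ∉ e} := by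
  classical
  have hmem : ∀ v w, v ∈ s(w, f w) → s(w, f w) = s(v, f v) := by
    intro v w h
    rcases Sym2.mem_iff.1 h with rfl | rfl
    · rfl
    · rw [hf.1 w, Sym2.eq_swap]
  refine ⟨(Finset.univ.filter fun v => f v ≠ v).image fun v => s(v, f v), ⟨?_, ?_⟩, ?_⟩
  · intro e he
    obtain ⟨v, hv, rfl⟩ := Finset.mem_image.1 he
    exact hf.2 v (Finset.mem_filter.1 hv).2
  · intro e he e' he' hne v hv hv'
    obtain ⟨w, -, rfl⟩ := Finset.mem_image.1 he
    obtain ⟨w', -, rfl⟩ := Finset.mem_image.1 he'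
    exact hne ((hmem v w hv).trans (hmem v w' hv').symm)
  · ext v
    refine ⟨fun hv e he hve => ?_, fun hv => ?_⟩
    · obtain ⟨w, hw, rfl⟩ := Finset.mem_image.1 he
      have hw := (Finset.mem_filter.1 hw).2
      have hv : f v = v := hv
      rcases Sym2.mem_iff.1 hve with rfl | rfl
      · exact hw hv
      · exact hw (hf.1.injective hv)
    · by_contra h
      exact hv _ (Finset.mem_image.2 ⟨v, Finset.mem_filter.2 ⟨Finset.mem_univ v, h⟩, rfl⟩)
        (Sym2.mem_mk_left _ _)

theorem IsMaximumMatchingFinset.exists_involution {V : Type*} [Fintype V] {G : SimpleGraph V}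
    {s : Finset (Sym2 V)} (hs : IsMaximumMatchingFinset G s) :
    ∃ f, IsMaximumInvolution G f ∧ Function.fixedPoints f = {v | ∀ e ∈ s, v ∉ e} := by
  obtain ⟨f, hf, hfs⟩ := hs.1.exists_involution
  refine ⟨f, ⟨hf, fun g hg => ?_⟩, hfs⟩
  obtain ⟨t, ht, hgt⟩ := hg.exists_finset
  have h1 := hs.1.ncard_uncovered_add
  have h2 := ht.ncard_uncovered_add
  have h3 := hs.2 t ht
  rw [hfs, hgt]
  omega

theorem SimpleGraph.IsMaximumInvolution.exists_finset {V : Type*} [Fintype V] {G : SimpleGraph V}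
    {f : V → V} (hf : IsMaximumInvolution G f) :
    ∃ s, IsMaximumMatchingFinset G s ∧ Function.fixedPoints f = {v | ∀ e ∈ s, v ∉ e} := by
  obtain ⟨s, hs, hfs⟩ := hf.1.exists_finset
  refine ⟨s, ⟨hs, fun t ht => ?_⟩, hfs⟩
  obtain ⟨g, hg, hgt⟩ := ht.exists_involution
  have h1 := hs.ncard_uncovered_add
  have h2 := ht.ncard_uncovered_add
  have h3 := hf.2 g hg
  rw [hfs, hgt] at h3
  omega

theorem gallaiD_eq_missable {V : Type*} [Fintype V] (G : SimpleGraph V) :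
    gallaiD G = missable G := by
  ext v
  constructor
  · rintro ⟨s, hs, hv⟩
    obtain ⟨f, hf, hfs⟩ := hs.exists_involution
    exact ⟨f, hf, show v ∈ Function.fixedPoints f from hfs ▸ hv⟩
  · rintro ⟨f, hf, hv⟩
    obtain ⟨s, hs, hfs⟩ := hf.exists_finset
    have hv : v ∈ Function.fixedPoints f := hv
    rw [hfs] at hv
    exact ⟨s, hs, hv⟩

/-- Gallai–Edmonds (e): if `q` is the number of connected components of the subgraph
induced by `D(G)`, then any maximum matching `M` of `G` satisfies
`|M| = (|V(G)| - q + |A(G)|) / 2`, i.e. `2|M| = |V(G)| - q + |A(G)|`. -/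
theorem gallai_edmonds_e {V : Type*} [Fintype V] (G : SimpleGraph V)
    (M : Finset (Sym2 V)) (hM : IsMaximumMatchingFinset G M) :
    (2 * M.card : ℤ) = (Fintype.card V : ℤ)
      - (Nat.card ((G.induce (gallaiD G)).ConnectedComponent) : ℤ)
      + ((gallaiA G).ncard : ℤ) := by
  obtain ⟨f, hf, hfM⟩ := hM.exists_involution
  have h1 := hM.1.ncard_uncovered_add
  rw [← hfM] at h1
  have h2 := hf.card_connectedComponent
  rw [hf.ncard_exits] at h2
  have hA : gallaiA G = missableBoundary G := by
    rw [gallaiA, gallaiD_eq_missable, missableBoundary]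
  rw [hA, gallaiD_eq_missable, h2]
  omega
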